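/- Let f be squarefree of degree d with no integer roots, let S ⊂ algebraic numbers be its set of roots, and suppose S admits a partition into r nonempty potent subsets S_1, ..., S_r. Then there exists a constant D = D(f) > 0 and N_0 such that for all N ≥ N_0 and every prime p > DN, the prime p divides at most d − r of the values f(1), f(2), ..., f(N). -/

import Mathlib

open Polynomial
open scoped Classical

/-- A nonempty finite set of algebraic numbers is potent if some
positive-integer combination of its elements is a rational integer. -/
def Potent (T : Finset (AlgebraicClosure ℚ)) : Prop :=
  T.Nonempty ∧ ∃ a : AlgebraicClosure ℚ → ℕ, (∀ β ∈ T, 0 < a β) ∧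
    ∃ z : ℤ, (∑ β ∈ T, (a β : AlgebraicClosure ℚ) * β) = (z : AlgebraicClosure ℚ)

/-- The ring of all algebraic integers maps to a field of any given prime characteristic. -/
theorem exists_ringHom_integralClosure_charP (p : ℕ) (hp : p.Prime) :
    ∃ (K : Type) (_ : Field K) (_ : CharP K p),
      Nonempty (integralClosure ℤ (AlgebraicClosure ℚ) →+* K) := by
  have hpZ : Prime (p : ℤ) := Nat.prime_iff_prime_int.mp hp
  have : (Ideal.span {(p : ℤ)}).IsPrime :=
    (Ideal.span_singleton_prime hpZ.ne_zero).mpr hpZ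
  obtain ⟨Q, hQ, hover⟩ := Ideal.exists_ideal_over_prime_of_isIntegral_of_isDomain
    (S := integralClosure ℤ (AlgebraicClosure ℚ)) (Ideal.span {(p : ℤ)}) (by
      rw [(RingHom.injective_iff_ker_eq_bot _).mp
        (FaithfulSMul.algebraMap_injective ℤ (integralClosure ℤ (AlgebraicClosure ℚ)))]
      exact bot_le)
  let φ := (algebraMap (integralClosure ℤ (AlgebraicClosure ℚ) ⧸ Q)
    (FractionRing (integralClosure ℤ (AlgebraicClosure ℚ) ⧸ Q))).comp (Ideal.Quotient.mk Q)
  refine ⟨FractionRing (integralClosure ℤ (AlgebraicClosure ℚ) ⧸ Q), inferInstance, ⟨fun n => ?_⟩,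
    ⟨φ⟩⟩
  have hcast : ((n : ℕ) : FractionRing (integralClosure ℤ (AlgebraicClosure ℚ) ⧸ Q)) = φ n :=
    (map_natCast φ n).symm
  have hmem : (n : integralClosure ℤ (AlgebraicClosure ℚ)) ∈ Q ↔
      (n : ℤ) ∈ Ideal.span {(p : ℤ)} := by
    rw [← hover, Ideal.mem_comap, map_natCast]
  rw [hcast, RingHom.comp_apply, FaithfulSMul.algebraMap_eq_zero_iff, Ideal.Quotient.eq_zero_iff_mem,
    hmem, Ideal.mem_span_singleton, Int.natCast_dvd_natCast]

/-- Modulo a prime not dividing the leading coefficient, the roots of `f` have reductions which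
exhaust the roots of `f` modulo `p` and inherit the linear relations between the roots of `f`. -/
theorem exists_reduction_roots (f : ℤ[X]) (p : ℕ) (hp : p.Prime)
    (hc : ¬ (p : ℤ) ∣ f.leadingCoeff) :
    ∃ (K : Type) (_ : Field K) (_ : CharP K p) (g : AlgebraicClosure ℚ → K),
      (∀ n : ℤ, (p : ℤ) ∣ f.eval n → ∃ β ∈ f.aroots (AlgebraicClosure ℚ), g β = n) ∧
      ∀ (T : Finset (AlgebraicClosure ℚ)) (a : AlgebraicClosure ℚ → ℕ) (z : ℤ),
        (∀ β ∈ T, β ∈ f.aroots (AlgebraicClosure ℚ)) →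
        ∑ β ∈ T, (a β : AlgebraicClosure ℚ) * β = z → ∑ β ∈ T, (a β : K) * g β = z := by
  obtain ⟨K, _, _, ⟨φ⟩⟩ := exists_ringHom_integralClosure_charP p hp
  set c := f.leadingCoeff
  have hcK : (c : K) ≠ 0 := fun h => hc ((CharP.intCast_eq_zero_iff K p c).mp h)
  have hintegral : ∀ β ∈ f.aroots (AlgebraicClosure ℚ),
      c • β ∈ integralClosure ℤ (AlgebraicClosure ℚ) := fun β hβ =>
    isIntegral_leadingCoeff_smul f β (mem_aroots'.mp hβ).2
  let b : AlgebraicClosure ℚ → integralClosure ℤ (AlgebraicClosure ℚ) := fun β =>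
    if h : β ∈ f.aroots (AlgebraicClosure ℚ) then ⟨c • β, hintegral β h⟩ else 0
  have hb : ∀ β ∈ f.aroots (AlgebraicClosure ℚ), (b β : AlgebraicClosure ℚ) = c * β := by
    intro β hβ
    simp only [b, dif_pos hβ, zsmul_eq_mul]
  refine ⟨K, inferInstance, inferInstance, fun β => φ (b β) / c, fun n hn => ?_,
    fun T a z hT hz => ?_⟩
  · have hfac : (c : integralClosure ℤ (AlgebraicClosure ℚ)) ^
          Multiset.card (f.aroots (AlgebraicClosure ℚ)) * (f.eval n : ℤ) =
        c * ((f.aroots (AlgebraicClosure ℚ)).map fun β =>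
          (c * n : ℤ) - b β).prod := by
      apply Subtype.val_injective
      have hspl : (f.map (algebraMap ℤ (AlgebraicClosure ℚ))).Splits := IsAlgClosed.splits _
      have hlc : (f.map (algebraMap ℤ (AlgebraicClosure ℚ))).leadingCoeff = c :=
        leadingCoeff_map_of_injective (FaithfulSMul.algebraMap_injective ℤ _) f
      have heval : ((f.eval n : ℤ) : AlgebraicClosure ℚ) =
          c * ((f.aroots (AlgebraicClosure ℚ)).map fun β => (n : AlgebraicClosure ℚ) - β).prod := by
        have h1 := hspl.eval_eq_prod_roots (n : AlgebraicClosure ℚ)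
        rw [hlc] at h1
        rw [← h1]
        rw [← eq_intCast (algebraMap ℤ (AlgebraicClosure ℚ)),
          ← eq_intCast (algebraMap ℤ (AlgebraicClosure ℚ)),
          eval_map_algebraMap, aeval_algebraMap_apply_eq_algebraMap_eval]
      have hprod : (((f.aroots (AlgebraicClosure ℚ)).map
          fun β => (c : AlgebraicClosure ℚ) * n - b β).prod) =
          (c : AlgebraicClosure ℚ) ^ Multiset.card (f.aroots (AlgebraicClosure ℚ)) *
          ((f.aroots (AlgebraicClosure ℚ)).map fun β => (n : AlgebraicClosure ℚ) - β).prod := by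
        rw [← Multiset.prod_replicate, ← Multiset.map_const', ← Multiset.prod_map_mul]
        refine congrArg _ (Multiset.map_congr rfl fun β hβ => ?_)
        rw [mul_sub, ← hb β hβ]
      push_cast
      simp only [Multiset.map_map, Function.comp_def]
      push_cast
      rw [heval, hprod]
      ring
    have h0 := congrArg φ hfac
    rw [map_mul, map_intCast, (CharP.intCast_eq_zero_iff K p _).mpr hn, mul_zero, map_mul,
      map_intCast, map_multiset_prod, Multiset.map_map, eq_comm, mul_eq_zero, or_iff_right hcK,
      Multiset.prod_eq_zero_iff, Multiset.mem_map] at h0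
    obtain ⟨β, hβ, h⟩ := h0
    refine ⟨β, hβ, ?_⟩
    simp only [Function.comp_apply, map_sub, map_intCast, sub_eq_zero] at h
    dsimp only
    rw [← h, Int.cast_mul, mul_div_cancel_left₀ _ hcK]
  · have hrel : ∑ β ∈ T, (a β : integralClosure ℤ (AlgebraicClosure ℚ)) * b β = c * z := by
      apply Subtype.val_injective
      push_cast
      rw [← hz, Finset.mul_sum]
      refine Finset.sum_congr rfl fun β hβ => ?_
      rw [hb β (hT β hβ)]
      ring
    have h := congrArg φ hrel
    simp only [map_sum, map_mul, map_natCast, map_intCast] at h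
    simp only [← mul_div_assoc]
    rw [← Finset.sum_div, h, mul_div_cancel_left₀ _ hcK]

/-- For `p` large in terms of a positive integral linear relation modulo `p`, the relation
cannot be solved by natural numbers `m β ≤ N` with `p ∣ f (m β)`. -/
theorem not_forall_dvd_eval_of_relation (f : ℤ[X]) (hroots : ∀ n : ℤ, f.eval n ≠ 0)
    {ι : Type*} (T : Finset ι) (hT : T.Nonempty) (a m : ι → ℕ) (ha : ∀ β ∈ T, 0 < a β)
    (z : ℤ) (N p : ℕ) (hm : ∀ β ∈ T, m β ≤ N)
    (hdvd : ∀ β ∈ T, (p : ℤ) ∣ f.eval (m β : ℤ))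
    (hrel : (p : ℤ) ∣ ∑ β ∈ T, (a β : ℤ) * m β - z)
    (hlt : (∑ β ∈ T, a β) * N + z.natAbs < p)
    (hval : ∀ n ≤ z.natAbs, (f.eval (n : ℤ)).natAbs < p) : False := by
  have hsum : ∑ β ∈ T, a β * m β ≤ (∑ β ∈ T, a β) * N := by
    rw [Finset.sum_mul]
    exact Finset.sum_le_sum fun β hβ => Nat.mul_le_mul_left _ (hm β hβ)
  have hcast : ∑ β ∈ T, (a β : ℤ) * m β = ((∑ β ∈ T, a β * m β : ℕ) : ℤ) := by push_cast; rfl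
  have hzero : ∑ β ∈ T, (a β : ℤ) * m β - z = 0 := by
    refine Int.eq_zero_of_abs_lt_dvd hrel ?_
    rw [hcast, abs_lt]
    omega
  obtain ⟨β, hβ⟩ := hT
  have hmz : m β ≤ z.natAbs := by
    have h1 : a β * m β ≤ ∑ β ∈ T, a β * m β :=
      Finset.single_le_sum (f := fun β => a β * m β) (fun _ _ => Nat.zero_le _) hβ
    have h2 : m β ≤ a β * m β := Nat.le_mul_of_pos_left _ (ha β hβ)
    omega
  refine hroots (m β) (Int.eq_zero_of_abs_lt_dvd (hdvd β hβ) ?_)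
  rw [Int.abs_eq_natAbs]
  exact_mod_cast hval _ hmz

/-- A subset `H` of `U` containing none of `r` pairwise disjoint subsets of `U` omits at least `r`
elements of `U`. -/
theorem card_le_sub_of_forall_not_subset {α : Type*} {r : ℕ} (S : Fin r → Finset α)
    (U H : Finset α) (hH : H ⊆ U) (hS : ∀ i, S i ⊆ U)
    (hdisj : ∀ i j, i ≠ j → Disjoint (S i) (S j)) (hnot : ∀ i, ¬ S i ⊆ H) :
    H.card ≤ U.card - r := by
  choose e he heH using fun i => Finset.not_subset.mp (hnot i)
  have hinj : Function.Injective e := fun i j hij => by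
    by_contra hne
    exact Finset.disjoint_left.mp (hdisj i j hne) (he i) (hij ▸ he j)
  have hle : (Finset.univ.image e).card ≤ (U \ H).card := by
    refine Finset.card_le_card fun x hx => ?_
    obtain ⟨i, -, rfl⟩ := Finset.mem_image.mp hx
    exact Finset.mem_sdiff.mpr ⟨hS i (he i), heH i⟩
  rw [Finset.card_image_of_injective _ hinj, Finset.card_fin, Finset.card_sdiff_of_subset hH] at hle
  have := Finset.card_le_card hH
  omega

/-- Let `f` be squarefree of degree `d` without integer roots whose root set
`S` admits a partition into `r` nonempty potent subsets. Then there are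
`D > 0` and `N₀` such that for all `N ≥ N₀`, every prime `p > D·N` divides at
most `d − r` of the values `f(1), …, f(N)`. -/
theorem stmt_7 (f : Polynomial ℤ) (d : ℕ) (hd : f.natDegree = d)
    (hsf : Squarefree f) (hroots : ∀ n : ℤ, f.eval n ≠ 0)
    (r : ℕ) (S : Fin r → Finset (AlgebraicClosure ℚ))
    (hpart : ∀ β : AlgebraicClosure ℚ,
      (β ∈ (f.aroots (AlgebraicClosure ℚ)).toFinset ↔ ∃ i, β ∈ S i))
    (hdisj : ∀ i j, i ≠ j → Disjoint (S i) (S j))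
    (hpot : ∀ i, Potent (S i)) :
    ∃ D : ℝ, 0 < D ∧ ∃ N₀ : ℕ, ∀ N : ℕ, N₀ ≤ N → ∀ p : ℕ, p.Prime →
      D * N < p →
      ((Finset.Icc 1 N).filter fun n : ℕ => (p : ℤ) ∣ f.eval (n : ℤ)).card
        ≤ d - r := by
  choose hne a ha z hz using hpot
  set A := ∑ i, ∑ β ∈ S i, a i β
  set Z := ∑ i, (z i).natAbs
  set B := ∑ n ∈ Finset.range (Z + 1), (f.eval (n : ℤ)).natAbs
  refine ⟨((A + Z + f.leadingCoeff.natAbs + B + 1 : ℕ) : ℝ), by positivity, 1,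
    fun N hN p hp hlt => ?_⟩
  have hlt' : (A + Z + f.leadingCoeff.natAbs + B + 1) * N < p := by exact_mod_cast hlt
  have hconst : A * N + Z + f.leadingCoeff.natAbs + B + N < p := by
    have hle := Nat.mul_le_mul_left (Z + f.leadingCoeff.natAbs + B) hN
    have hdistrib : (A + Z + f.leadingCoeff.natAbs + B + 1) * N =
      A * N + (Z + f.leadingCoeff.natAbs + B) * N + N := by ring
    omega
  have hf0 : f.leadingCoeff ≠ 0 := by
    rw [Ne, leadingCoeff_eq_zero]
    rintro rfl
    exact hroots 0 eval_zero
  have hc : ¬ (p : ℤ) ∣ f.leadingCoeff := fun h =>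
    hf0 (Int.eq_zero_of_abs_lt_dvd h (by rw [Int.abs_eq_natAbs]; omega))
  obtain ⟨K, _, _, g, hg, hgrel⟩ := exists_reduction_roots f p hp hc
  set M := (Finset.Icc 1 N).filter fun n : ℕ => (p : ℤ) ∣ f.eval (n : ℤ)
  have hM : ∀ n ∈ M, n ≤ N ∧ (p : ℤ) ∣ f.eval (n : ℤ) := fun n hn =>
    ⟨(Finset.mem_Icc.mp (Finset.mem_filter.mp hn).1).2, (Finset.mem_filter.mp hn).2⟩
  set U := (f.aroots (AlgebraicClosure ℚ)).toFinset
  have hex : ∀ n : ℕ, ∃ β, n ∈ M → β ∈ U ∧ g β = n := fun n => by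
    by_cases hn : n ∈ M
    · obtain ⟨β, hβ, h⟩ := hg n (hM n hn).2
      exact ⟨β, fun _ => ⟨Multiset.mem_toFinset.mpr hβ, by simpa using h⟩⟩
    · exact ⟨0, fun h => absurd h hn⟩
  choose h hh using hex
  have hinj : Set.InjOn h M := fun m hm n hn hmn => by
    have hK : (m : K) = n := by rw [← (hh m hm).2, ← (hh n hn).2, hmn]
    have hmod := (CharP.natCast_eq_natCast K p).mp hK
    have := (hM m hm).1
    have := (hM n hn).1
    exact Nat.ModEq.eq_of_lt_of_lt hmod (by omega) (by omega)
  have hSU : ∀ i, S i ⊆ U := fun i β hβ => (hpart β).mpr ⟨i, hβ⟩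
  have hU : U.card ≤ d := by
    refine (Multiset.toFinset_card_le _).trans ((card_roots' _).trans ?_)
    rw [← hd]
    exact natDegree_map_le
  rw [← Finset.card_image_of_injOn hinj]
  refine (card_le_sub_of_forall_not_subset S U _ ?_ hSU hdisj fun i hi => ?_).trans
    (Nat.sub_le_sub_right hU r)
  · intro β hβ
    obtain ⟨n, hn, rfl⟩ := Finset.mem_image.mp hβ
    exact (hh n hn).1
  have hex' : ∀ β, ∃ n, β ∈ S i → n ∈ M ∧ g β = n := fun β => by
    by_cases hβ : β ∈ S i
    · obtain ⟨n, hn, rfl⟩ := Finset.mem_image.mp (hi hβ)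
      exact ⟨n, fun _ => ⟨hn, (hh n hn).2⟩⟩
    · exact ⟨0, fun h => absurd h hβ⟩
  choose m hm using hex'
  have hAi : ∑ β ∈ S i, a i β ≤ A :=
    Finset.single_le_sum (f := fun i => ∑ β ∈ S i, a i β) (fun _ _ => Nat.zero_le _)
      (Finset.mem_univ i)
  have hZi : (z i).natAbs ≤ Z :=
    Finset.single_le_sum (f := fun i => (z i).natAbs) (fun _ _ => Nat.zero_le _)
      (Finset.mem_univ i)
  refine not_forall_dvd_eval_of_relation f hroots (S i) (hne i) (a i) m (ha i) (z i) N p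
    (fun β hβ => (hM _ (hm β hβ).1).1) (fun β hβ => (hM _ (hm β hβ).1).2) ?_ ?_ fun n hn => ?_
  · rw [← CharP.intCast_eq_zero_iff K p]
    push_cast
    rw [sub_eq_zero, ← hgrel (S i) (a i) (z i)
      (fun β hβ => Multiset.mem_toFinset.mp (hSU i hβ)) (hz i)]
    exact Finset.sum_congr rfl fun β hβ => by rw [(hm β hβ).2]
  · have := Nat.mul_le_mul_right N hAi
    omega
  · have : (f.eval (n : ℤ)).natAbs ≤ B :=
      Finset.single_le_sum (f := fun n : ℕ => (f.eval (n : ℤ)).natAbs) (fun _ _ => Nat.zero_le _)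
        (Finset.mem_range.mpr (by omega))
    omega
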